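/- Let N ≥ 4 be a real number and let y be a smooth function on [0,1] that vanishes on a neighborhood of z = 1 (i.e., y ∈ C₀^∞[0,1)). Then for every integer n ≥ 1: (y)_n² ≤ (y)_{n+1}·(y)_{n−1}, where (y)_{2m} = ‖Δ^m y‖_𝔛 and (y)_{2m+1} = ‖Ḋ Δ^m y‖_𝔛. Consequently, the grading (‖·‖_n)_n given by ‖y‖_n = (∑_{0≤ℓ≤n} (y)_ℓ²)^{1/2} satisfies ‖y‖_n² ≤ ‖y‖_{n−1}·‖y‖_{n+1} for such y. -/

import Mathlib

open MeasureTheory Real Set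

noncomputable section

/-- The degenerate operator `Δy(z) = z y''(z) + (N/2) y'(z)`. -/
def Del (N : ℝ) (f : ℝ → ℝ) : ℝ → ℝ :=
  fun z => z * deriv (deriv f) z + (N / 2) * deriv f z

/-- Iterates `Δ^m`. -/
def DelIter (N : ℝ) : ℕ → (ℝ → ℝ) → ℝ → ℝ
  | 0 => fun f => f
  | m + 1 => fun f => Del N (DelIter N m f)

/-- `Ḋ = √z d/dz`. -/
def Ddot (f : ℝ → ℝ) : ℝ → ℝ := fun z => Real.sqrt z * deriv f z

/-- The weighted L² norm on (0,1). -/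
def Xnorm (N : ℝ) (f : ℝ → ℝ) : ℝ :=
  Real.sqrt (∫ z in (0:ℝ)..1, (f z) ^ 2 * z ^ (N / 2 - 1))

/-- Graded seminorms `(y)_ℓ`. -/
def gnorm (N : ℝ) (ℓ : ℕ) (f : ℝ → ℝ) : ℝ :=
  if ℓ % 2 = 0 then Xnorm N (DelIter N (ℓ / 2) f)
  else Xnorm N (Ddot (DelIter N (ℓ / 2) f))

/-- Graded norm `‖y‖_n`. -/
def normN (N : ℝ) (n : ℕ) (f : ℝ → ℝ) : ℝ :=
  Real.sqrt (∑ ℓ ∈ Finset.range (n + 1), (gnorm N ℓ f) ^ 2)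

/-- Sup norm on [0,1]. -/
def supN (f : ℝ → ℝ) : ℝ := ⨆ z : Icc (0:ℝ) 1, |f z.1|

/-- `|y|_n = ∑_{ℓ≤n} ‖Ḋ^ℓ y‖_{L^∞(0,1)}`. -/
def supLow (n : ℕ) (f : ℝ → ℝ) : ℝ := ∑ ℓ ∈ Finset.range (n + 1), supN (Ddot^[ℓ] f)

/-- Time derivative of a function of (t,z). -/
def dt (y : ℝ → ℝ → ℝ) : ℝ → ℝ → ℝ := fun t z => deriv (fun s => y s z) t

/-- Sup norm on [0,T]×[0,1]. -/
def supT (T : ℝ) (y : ℝ → ℝ → ℝ) : ℝ :=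
  ⨆ (t : Icc (0:ℝ) T) (z : Icc (0:ℝ) 1), |y t.1 z.1|

/-- `|y|_n^T = sup_{j+k≤n} ‖∂_t^j Ḋ^k y‖_{L^∞([0,T]×[0,1])}`. -/
def supNT (T : ℝ) (n : ℕ) (y : ℝ → ℝ → ℝ) : ℝ :=
  ⨆ p : {p : ℕ × ℕ // p.1 + p.2 ≤ n}, supT T (fun t => Ddot^[p.1.2] (dt^[p.1.1] y t))

/-- `‖y‖_n^T`. -/
def normT (N T : ℝ) (n : ℕ) (y : ℝ → ℝ → ℝ) : ℝ :=
  Real.sqrt (∑ j ∈ Finset.range (n + 1), ∑ k ∈ Finset.range (n + 1 - j),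
    ∫ t in (0:ℝ)..T, (normN N k (dt^[j] y t)) ^ 2)

/-- `Z_n(H)(t) = ∑_{j+k=n} ‖∂_t^j H(t,·)‖_k`. -/
def ZZ (N : ℝ) (n : ℕ) (H : ℝ → ℝ → ℝ) (t : ℝ) : ℝ :=
  ∑ j ∈ Finset.range (n + 1), normN N (n - j) (dt^[j] H t)

/-- The operator `𝒜h = -b₂ Δh + b₁ Ďh + b₀ h` with time-dependent coefficients. -/
def opA (N : ℝ) (b₂ b₁ b₀ : ℝ → ℝ → ℝ) (H : ℝ → ℝ → ℝ) : ℝ → ℝ → ℝ :=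
  fun t z => -(b₂ t z) * Del N (H t) z + b₁ t z * (z * deriv (H t) z) + b₀ t z * H t z

end

/-- Weighted integral. -/
noncomputable def Wt (N : ℝ) (f : ℝ → ℝ) : ℝ := ∫ z in (0:ℝ)..1, f z * z ^ (N / 2 - 1)

lemma wt_int {N : ℝ} (hN : 4 ≤ N) {f : ℝ → ℝ} (hf : ContinuousOn f (Icc 0 1)) :
    IntervalIntegrable (fun z : ℝ => f z * z ^ (N / 2 - 1)) volume 0 1 := by
  apply ContinuousOn.intervalIntegrable
  rw [uIcc_of_le zero_le_one]
  exact hf.mul (Real.continuous_rpow_const (by linarith)).continuousOn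

lemma wt_add {N : ℝ} (hN : 4 ≤ N) {f g : ℝ → ℝ} (hf : ContinuousOn f (Icc 0 1))
    (hg : ContinuousOn g (Icc 0 1)) : Wt N (fun z => f z + g z) = Wt N f + Wt N g := by
  unfold Wt
  rw [← intervalIntegral.integral_add (wt_int hN hf) (wt_int hN hg)]
  congr 1; ext z; ring

lemma wt_smul {N : ℝ} (c : ℝ) {f : ℝ → ℝ} : Wt N (fun z => c * f z) = c * Wt N f := by
  unfold Wt
  rw [← intervalIntegral.integral_const_mul]
  congr 1; ext z; ring

lemma wt_congr {N : ℝ} {f g : ℝ → ℝ} (h : ∀ z ∈ Icc (0:ℝ) 1, f z = g z) : Wt N f = Wt N g := by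
  unfold Wt
  apply intervalIntegral.integral_congr
  intro z hz
  rw [uIcc_of_le zero_le_one] at hz
  simp only [h z hz]

lemma wt_nonneg {N : ℝ} {f : ℝ → ℝ} (h : ∀ z ∈ Icc (0:ℝ) 1, 0 ≤ f z) : 0 ≤ Wt N f := by
  unfold Wt
  apply intervalIntegral.integral_nonneg zero_le_one
  intro z hz
  exact mul_nonneg (h z hz) (Real.rpow_nonneg hz.1 _)

/-- Cauchy-Schwarz. -/
lemma wt_cs {N : ℝ} (hN : 4 ≤ N) {f g : ℝ → ℝ} (hf : ContinuousOn f (Icc 0 1))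
    (hg : ContinuousOn g (Icc 0 1)) :
    (Wt N (fun z => f z * g z)) ^ 2 ≤ Wt N (fun z => f z ^ 2) * Wt N (fun z => g z ^ 2) := by
  have h : ∀ t : ℝ, 0 ≤ Wt N (fun z => f z ^ 2) * (t * t) + (2 * Wt N (fun z => f z * g z)) * t
      + Wt N (fun z => g z ^ 2) := by
    intro t
    have h0 : 0 ≤ Wt N (fun z => ((t * t) * (f z ^ 2) + (2 * t) * (f z * g z)) + g z ^ 2) := by
      apply wt_nonneg
      intro z _
      nlinarith [sq_nonneg (t * f z + g z)]
    rw [wt_add hN (by fun_prop) (by fun_prop), wt_add hN (by fun_prop) (by fun_prop),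
      wt_smul, wt_smul] at h0
    linarith
  have := discrim_le_zero h
  unfold discrim at this
  linarith

/-- Divergence theorem. -/
lemma wt_div {N : ℝ} (hN : 4 ≤ N) {G G' : ℝ → ℝ}
    (hG : ∀ z ∈ Icc (0:ℝ) 1, HasDerivAt G (G' z) z) (hc : ContinuousOn G' (Icc 0 1))
    (h1 : G 1 = 0) : Wt N (fun z => z * G' z + (N / 2) * G z) = 0 := by
  have hGc : ContinuousOn G (Icc 0 1) := fun z hz => (hG z hz).continuousAt.continuousWithinAt
  unfold Wt
  rw [intervalIntegral.integral_eq_sub_of_hasDerivAt (f := fun z => z ^ (N / 2) * G z) _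
    (wt_int hN (by fun_prop))]
  · rw [h1, Real.zero_rpow (by linarith)]; simp
  · intro z hz
    rw [uIcc_of_le zero_le_one] at hz
    have := (Real.hasDerivAt_rpow_const (x := z) (p := N / 2) (Or.inr (by linarith))).mul (hG z hz)
    refine HasDerivAt.congr_deriv this ?_
    have : z ^ (N / 2) = z ^ (N / 2 - 1) * z := by
      conv_lhs => rw [show N / 2 = (N / 2 - 1) + 1 by ring]
      rw [Real.rpow_add_one' hz.1 (by linarith)]
    rw [this]; ring

lemma cd_deriv {f : ℝ → ℝ} (hf : ContDiff ℝ (⊤ : ℕ∞) f) : ContDiff ℝ (⊤ : ℕ∞) (deriv f) := by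
  exact (contDiff_infty_iff_deriv.1 hf).2

lemma cd_hasDeriv {f : ℝ → ℝ} (hf : ContDiff ℝ (⊤ : ℕ∞) f) (z : ℝ) :
    HasDerivAt f (deriv f z) z :=
  ((contDiff_infty_iff_deriv.1 hf).1 z).hasDerivAt

/-- Integration by parts. -/
lemma wt_parts {N : ℝ} (hN : 4 ≤ N) {f h : ℝ → ℝ} (hf : ContDiff ℝ (⊤ : ℕ∞) f)
    (hh : ContDiff ℝ (⊤ : ℕ∞) h) (h1 : h 1 = 0) :
    Wt N (fun z => Del N f z * h z) = - Wt N (fun z => Ddot f z * Ddot h z) := by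
  have c1 := (cd_deriv hf).continuous
  have c2 := (cd_deriv (cd_deriv hf)).continuous
  have c3 := (cd_deriv hh).continuous
  have c4 := hh.continuous
  have key := wt_div hN (G := fun z => deriv f z * h z)
    (G' := fun z => deriv (deriv f) z * h z + deriv f z * deriv h z)
    (fun z _ => (cd_hasDeriv (cd_deriv hf) z).mul (cd_hasDeriv hh z))
    (by fun_prop) (by simp [h1])
  have e : Wt N (fun z => z * (deriv (deriv f) z * h z + deriv f z * deriv h z)
      + (N / 2) * (deriv f z * h z)) =
      Wt N (fun z => Del N f z * h z + Ddot f z * Ddot h z) := by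
    apply wt_congr
    intro z hz
    have := Real.mul_self_sqrt hz.1
    simp only [Del, Ddot]
    linear_combination (-(deriv f z * deriv h z)) * this
  rw [e, wt_add hN] at key
  · linarith
  · unfold Del; fun_prop
  · unfold Ddot; fun_prop

lemma del_cd {N : ℝ} {f : ℝ → ℝ} (hf : ContDiff ℝ (⊤ : ℕ∞) f) :
    ContDiff ℝ (⊤ : ℕ∞) (Del N f) := by
  have c1 := (cd_deriv hf)
  have c2 := (cd_deriv (cd_deriv hf))
  unfold Del
  fun_prop

lemma deriv_van {f : ℝ → ℝ} {a : ℝ} (h : ∀ z, a < z → f z = 0) : ∀ z, a < z → deriv f z = 0 := by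
  intro z hz
  have : f =ᶠ[nhds z] (fun _ => 0) := by
    filter_upwards [Ioi_mem_nhds hz] with x hx using h x hx
  rw [this.deriv_eq]; simp

lemma iter_good {N : ℝ} {y : ℝ → ℝ} {a : ℝ} (hy : ContDiff ℝ (⊤ : ℕ∞) y)
    (h : ∀ z, a < z → y z = 0) (m : ℕ) :
    ContDiff ℝ (⊤ : ℕ∞) (DelIter N m y) ∧ ∀ z, a < z → DelIter N m y z = 0 := by
  induction m with
  | zero => exact ⟨hy, h⟩
  | succ m ih =>
    refine ⟨del_cd ih.1, fun z hz => ?_⟩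
    have h1 := deriv_van ih.2
    have h2 := deriv_van h1
    simp [DelIter, Del, h1 z hz, h2 z hz]

/-- The pointwise polynomial inequality. -/
lemma poly_ineq (m z : ℝ) (hm : 0 ≤ m) (hz : 0 ≤ z) (s : ℝ) (hs : 0 ≤ s) (hzs : z + s = 1) :
    z * ((2 + m) / 10) ^ 2 * (2 - z) ^ 6 ≤ (6 / 5 - 4 / 25 * z - z ^ 2) *
      ((13 / 5) ^ 2 / 4 * (z + (2 + m) * (2 - z)) ^ 2
        + z * ((13 / 5) ^ 2 / 2) * ((2 - z) + 2 * z + (2 + m) * (2 - z))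
        - 13 / 10 * z * (4 * (2 - z) + 6 * z + 2 * (2 + m) * (2 - z))
        - (2 + m) * (13 / 10) * ((2 - z) ^ 2 + 2 * z * (2 - z) + (2 + m) * (2 - z) ^ 2)
        + (2 + m) ^ 2 / 10 * (2 - z) ^ 4) := by
  obtain rfl : s = 1 - z := by linarith
  rw [← sub_nonneg]
  have e : 0 ≤ m ^ 2 * (474/125 * (1-z)^7 + 12304/625 * z * (1-z)^6 + 10339/250 * z^2 * (1-z)^5
      + 56447/1250 * z^3 * (1-z)^4 + 67841/2500 * z^4 * (1-z)^3 + 21359/2500 * z^5 * (1-z)^2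
      + 2807/2500 * z^6 * (1-z) + 6/625 * z^7)
    + m * (1116/125 * (1-z)^7 + 28676/625 * z * (1-z)^6 + 62323/625 * z^2 * (1-z)^5
      + 14849/125 * z^3 * (1-z)^4 + 20561/250 * z^4 * (1-z)^3 + 7787/250 * z^5 * (1-z)^2
      + 6277/1250 * z^6 * (1-z) + 61/1250 * z^7)
    + (336/125 * (1-z)^7 + 5406/625 * z * (1-z)^6 + 2837/250 * z^2 * (1-z)^5
      + 15513/1250 * z^3 * (1-z)^4 + 36389/2500 * z^4 * (1-z)^3 + 25311/2500 * z^5 * (1-z)^2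
      + 6613/2500 * z^6 * (1-z) + 31/2500 * z^7) := by
    generalize (1 - z) = s at hs
    positivity
  refine e.trans_eq ?_
  ring

lemma quad_ineq (ν z d y y1 : ℝ) (hν : 2 ≤ ν) (hz : z ∈ Icc (0:ℝ) 1) (hd : d = 1 / (2 - z)) :
    0 ≤ z * y1 ^ 2 * (2 * z * (13 / 5 * d ^ 2) + 13 / 5 * d - z * (13 / 5 * d) ^ 2 - 1)
      + 2 * z * (ν / 10) * y * y1
      + y ^ 2 * ((13 / 10 * (z * d ^ 2 + ν * d)) ^ 2
        + z * (13 / 5 * d) * (13 / 10 * (d ^ 2 + 2 * z * d ^ 3 + ν * d ^ 2))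
        - z * (13 / 10 * (4 * d ^ 3 + 6 * z * d ^ 4 + 2 * ν * d ^ 3))
        - ν * (13 / 10 * (d ^ 2 + 2 * z * d ^ 3 + ν * d ^ 2)) + ν ^ 2 / 10) := by
  obtain ⟨h0, h1⟩ := hz
  have hD : 0 < 2 - z := by linarith
  have P := poly_ineq (ν - 2) z (by linarith) h0 (1 - z) (by linarith) (by ring)
  rw [show 2 + (ν - 2) = ν by ring] at P
  set R := ((13 / 5) ^ 2 / 4 * (z + ν * (2 - z)) ^ 2
        + z * ((13 / 5) ^ 2 / 2) * ((2 - z) + 2 * z + ν * (2 - z))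
        - 13 / 10 * z * (4 * (2 - z) + 6 * z + 2 * ν * (2 - z))
        - ν * (13 / 10) * ((2 - z) ^ 2 + 2 * z * (2 - z) + ν * (2 - z) ^ 2)
        + ν ^ 2 / 10 * (2 - z) ^ 4) with hR
  have hmu : 0 < 6 / 5 - 4 / 25 * z - z ^ 2 := by nlinarith
  have hE : 0 ≤ z * (6 / 5 - 4 / 25 * z - z ^ 2) * (2 - z) ^ 2 * y1 ^ 2
      + 2 * z * (ν / 10) * (2 - z) ^ 4 * y * y1 + R * y ^ 2 := by
    have : 0 ≤ (6 / 5 - 4 / 25 * z - z ^ 2) *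
      (z * (6 / 5 - 4 / 25 * z - z ^ 2) * (2 - z) ^ 2 * y1 ^ 2
      + 2 * z * (ν / 10) * (2 - z) ^ 4 * y * y1 + R * y ^ 2) := by
      have a := mul_nonneg h0
        (sq_nonneg ((6 / 5 - 4 / 25 * z - z ^ 2) * (2 - z) * y1 + ν / 10 * (2 - z) ^ 3 * y))
      have b := mul_nonneg (sub_nonneg.2 P) (sq_nonneg y)
      linear_combination a + b
    exact nonneg_of_mul_nonneg_right this hmu
  have := div_nonneg hE (pow_pos hD 4).le
  refine this.trans_eq ?_
  rw [hR, hd]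
  field_simp
  ring

lemma key_ineq {N : ℝ} (hN : 4 ≤ N) {y : ℝ → ℝ} (hy : ContDiff ℝ (⊤ : ℕ∞) y)
    (h1 : y 1 = 0) (h2 : deriv y 1 = 0) (r : ℝ) :
    0 ≤ Wt N (fun z => (Del N y z + r * y z) ^ 2 - z * deriv y z ^ 2) := by
  have c0 := hy.continuous
  have c1 := (cd_deriv hy).continuous
  have c2 := (cd_deriv (cd_deriv hy)).continuous
  set y1 := deriv y with hy1
  set y2 := deriv y1 with hy2
  have dy : ∀ z, HasDerivAt y (y1 z) z := cd_hasDeriv hy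
  have dy1 : ∀ z, HasDerivAt y1 (y2 z) z := cd_hasDeriv (cd_deriv hy)
  let d : ℝ → ℝ := fun z => 1 / (2 - z)
  have dd : ∀ z ∈ Icc (0:ℝ) 1, HasDerivAt d (d z ^ 2) z := by
    intro z hz
    have hD : (2 - z) ≠ 0 := by have := hz.2; intro h; linarith
    have := ((hasDerivAt_id z).const_sub 2).inv hD
    have e : d = (fun x => 2 - id x)⁻¹ := by
      funext x; simp [d]
    rw [e]
    refine this.congr_deriv ?_
    simp
  have cd : ContinuousOn d (Icc 0 1) := fun z hz => (dd z hz).continuousAt.continuousWithinAt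
  let ν := N / 2
  let g : ℝ → ℝ := fun z => 13 / 5 * d z
  let g1 : ℝ → ℝ := fun z => 13 / 5 * d z ^ 2
  let c : ℝ → ℝ := fun z => 13 / 10 * (z * d z ^ 2 + ν * d z)
  let e1 : ℝ → ℝ := fun z => 13 / 10 * (d z ^ 2 + 2 * z * d z ^ 3 + ν * d z ^ 2)
  let e2 : ℝ → ℝ := fun z => 13 / 10 * (4 * d z ^ 3 + 6 * z * d z ^ 4 + 2 * ν * d z ^ 3)
  have dg : ∀ z ∈ Icc (0:ℝ) 1, HasDerivAt g (g1 z) z := fun z hz => (dd z hz).const_mul _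
  have dc : ∀ z ∈ Icc (0:ℝ) 1, HasDerivAt c (e1 z) z := by
    intro z hz
    have := (((hasDerivAt_id z).mul ((dd z hz).pow 2)).add ((dd z hz).const_mul ν)).const_mul
      (13 / 10 : ℝ)
    refine HasDerivAt.congr_deriv this ?_
    simp [e1]; ring
  have de : ∀ z ∈ Icc (0:ℝ) 1, HasDerivAt e1 (e2 z) z := by
    intro z hz
    have := ((((dd z hz).pow 2).add (((hasDerivAt_id z).const_mul 2).mul ((dd z hz).pow 3))).add
      (((dd z hz).pow 2).const_mul ν)).const_mul (13 / 10 : ℝ)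
    refine HasDerivAt.congr_deriv this ?_
    simp [e2]; ring
  let G : ℝ → ℝ := fun z => z * (g z * y1 z ^ 2) + 2 * (c z * (y z * y1 z))
    + (r * g z + g z * c z + ν / 10 - e1 z) * y z ^ 2
  let G' : ℝ → ℝ := fun z => (g z * y1 z ^ 2 + z * (g1 z * y1 z ^ 2 + g z * (2 * y1 z * y2 z)))
    + 2 * (e1 z * (y z * y1 z) + c z * (y1 z * y1 z + y z * y2 z))
    + ((r * g1 z + (g1 z * c z + g z * e1 z) - e2 z) * y z ^ 2
      + (r * g z + g z * c z + ν / 10 - e1 z) * (2 * y z * y1 z))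
  have dG : ∀ z ∈ Icc (0:ℝ) 1, HasDerivAt G (G' z) z := by
    intro z hz
    have A := (hasDerivAt_id z).mul ((dg z hz).mul ((dy1 z).pow 2))
    have B := ((dc z hz).mul ((dy z).mul (dy1 z))).const_mul 2
    have C := ((((((dg z hz).const_mul r).add ((dg z hz).mul (dc z hz))).add_const (ν / 10)).sub
      (de z hz))).mul ((dy z).pow 2)
    have := (A.add B).add C
    refine HasDerivAt.congr_deriv this ?_
    simp [G']
  have cG' : ContinuousOn G' (Icc 0 1) := by
    simp only [G', g, g1, c, e1, e2]
    fun_prop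
  have cG : ContinuousOn G (Icc 0 1) := fun z hz => (dG z hz).continuousAt.continuousWithinAt
  have hdiv := wt_div hN dG cG' (by simp [G, h1, h2])
  have hadd := wt_add hN (f := fun z => (Del N y z + r * y z) ^ 2 - z * y1 z ^ 2)
    (g := fun z => z * G' z + (N / 2) * G z)
    (by have := (del_cd (N := N) hy).continuous; fun_prop) (by fun_prop)
  rw [hdiv, add_zero] at hadd
  rw [← hadd]
  apply wt_nonneg
  intro z hz
  have hq := quad_ineq ν z (d z) (y z) (y1 z) (by simp only [ν]; linarith) hz rfl
  have hs := sq_nonneg (z * y2 z + ν * y1 z + r * y z + (z * g z * y1 z + c z * y z))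
  refine (add_nonneg hs hq).trans_eq ?_
  simp only [Del, G, G', g, g1, c, e1, e2, ν, ← hy1, ← hy2]
  ring

lemma seq_ineq (A : ℕ → ℝ) (hA : ∀ n, 0 ≤ A n) (hl : ∀ n, A (n+1) ^ 2 ≤ A n * A (n+2))
    (h0 : A 0 * A 1 + A 1 ^ 2 ≤ A 0 * A 2) (n : ℕ) :
    A (n+1) * (∑ l ∈ Finset.range (n+2), A l) ≤ (∑ l ∈ Finset.range (n+1), A l) * A (n+2) := by
  induction n with
  | zero => simp [Finset.sum_range_succ]; linarith
  | succ n ih =>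
    rw [Finset.sum_range_succ _ (n+2)]
    rw [Finset.sum_range_succ _ (n+1)] at ih ⊢
    have hT : 0 ≤ ∑ l ∈ Finset.range (n+1), A l := Finset.sum_nonneg fun l _ => hA l
    generalize (∑ l ∈ Finset.range (n+1), A l) = T at *
    have l1 := hl (n+1)
    have p1 := hA (n+1)
    have p2 := hA (n+2)
    have p3 := hA (n+3)
    simp only [show n + 1 + 1 = n + 2 by ring, show n + 1 + 2 = n + 3 by ring] at *
    rcases p1.eq_or_lt with h | h
    · rw [← h] at l1
      have : A (n+2) = 0 := by nlinarith
      rw [this, ← h]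
      have := mul_nonneg hT p3
      nlinarith
    · have : 0 ≤ A (n+1) * ((T + A (n+1)) * A (n+3) - A (n+2) * (T + A (n+1) + A (n+2))) := by
        have a := mul_nonneg (add_nonneg hT p1) (sub_nonneg.2 l1)
        have b := mul_nonneg p2 (sub_nonneg.2 ih)
        nlinarith
      have := nonneg_of_mul_nonneg_right this h
      linarith

lemma xnorm_sq (N : ℝ) (f : ℝ → ℝ) : Xnorm N f ^ 2 = Wt N (fun z => f z ^ 2) := by
  unfold Xnorm
  rw [Real.sq_sqrt]
  · rfl
  · exact wt_nonneg (N := N) (f := fun z => f z ^ 2) (fun z _ => sq_nonneg _)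

lemma gnorm_even (N : ℝ) (m : ℕ) (y : ℝ → ℝ) :
    gnorm N (2 * m) y = Xnorm N (DelIter N m y) := by
  simp [gnorm]

lemma gnorm_odd (N : ℝ) (m : ℕ) (y : ℝ → ℝ) :
    gnorm N (2 * m + 1) y = Xnorm N (Ddot (DelIter N m y)) := by
  simp [gnorm, show (2 * m + 1) / 2 = m by omega]

lemma gnorm_nonneg (N : ℝ) (m : ℕ) (y : ℝ → ℝ) : 0 ≤ gnorm N m y := by
  unfold gnorm Xnorm
  split_ifs <;> exact Real.sqrt_nonneg _

lemma ddot_cont {f : ℝ → ℝ} (hf : ContDiff ℝ (⊤ : ℕ∞) f) : Continuous (Ddot f) := by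
  have := (cd_deriv hf).continuous
  unfold Ddot; fun_prop

lemma logconv {N : ℝ} (hN : 4 ≤ N) {y : ℝ → ℝ} (hy : ContDiff ℝ (⊤ : ℕ∞) y) {a : ℝ} (ha : a < 1)
    (h : ∀ z, a < z → y z = 0) (n : ℕ) :
    (gnorm N (n+1) y ^ 2) ^ 2 ≤ gnorm N n y ^ 2 * gnorm N (n+2) y ^ 2 := by
  obtain ⟨m, rfl | rfl⟩ : ∃ m, n = 2 * m ∨ n = 2 * m + 1 := ⟨n / 2, by omega⟩
  · obtain ⟨hu, hv⟩ := iter_good (N := N) hy h m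
    rw [show 2 * m + 2 = 2 * (m + 1) by ring, gnorm_odd, gnorm_even, gnorm_even]
    simp only [xnorm_sq, DelIter]
    have p := wt_parts hN hu hu (hv 1 ha)
    have q := wt_cs hN hu.continuous.continuousOn (del_cd (N := N) hu).continuous.continuousOn
    have e : Wt N (fun z => Ddot (DelIter N m y) z ^ 2) =
        - Wt N (fun z => DelIter N m y z * Del N (DelIter N m y) z) := by
      simp only [sq, mul_comm (DelIter N m y _)]
      linarith
    rw [e, neg_sq]
    exact q
  · obtain ⟨hu, hv⟩ := iter_good (N := N) hy h m
    obtain ⟨hu', hv'⟩ := iter_good (N := N) hy h (m + 1)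
    rw [show 2 * m + 1 + 1 = 2 * (m + 1) by ring, show 2 * m + 1 + 2 = 2 * (m + 1) + 1 by ring,
      gnorm_odd, gnorm_even, gnorm_odd]
    simp only [xnorm_sq]
    have p := wt_parts hN hu hu' (hv' 1 ha)
    have q := wt_cs hN (ddot_cont hu).continuousOn (ddot_cont hu').continuousOn
    have e : Wt N (fun z => DelIter N (m+1) y z ^ 2) =
        - Wt N (fun z => Ddot (DelIter N m y) z * Ddot (DelIter N (m+1) y) z) := by
      rw [← p]
      simp only [sq]
      rfl
    rw [e, neg_sq]
    exact q

lemma base_ineq {N : ℝ} (hN : 4 ≤ N) {y : ℝ → ℝ} (hy : ContDiff ℝ (⊤ : ℕ∞) y) {a : ℝ}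
    (ha : a < 1) (h : ∀ z, a < z → y z = 0) :
    gnorm N 0 y ^ 2 * gnorm N 1 y ^ 2 + (gnorm N 1 y ^ 2) ^ 2
      ≤ gnorm N 0 y ^ 2 * gnorm N 2 y ^ 2 := by
  have L := logconv hN hy ha h 0
  have k := key_ineq hN hy (h 1 ha) (deriv_van h 1 ha)
  have p := wt_parts hN hy hy (h 1 ha)
  have g0 : gnorm N 0 y ^ 2 = Wt N (fun z => y z ^ 2) := by
    rw [← xnorm_sq]; rfl
  have g1 : gnorm N 1 y ^ 2 = Wt N (fun z => Ddot y z ^ 2) := by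
    rw [← xnorm_sq]; rfl
  have g2 : gnorm N 2 y ^ 2 = Wt N (fun z => Del N y z ^ 2) := by
    rw [← xnorm_sq]; rfl
  simp only [zero_add] at L
  have n0 := sq_nonneg (gnorm N 0 y)
  have cy := hy.continuous
  have cD := (del_cd (N := N) hy).continuous
  have cd := ddot_cont hy
  have kk : ∀ r : ℝ, 0 ≤ gnorm N 2 y ^ 2 - 2 * r * gnorm N 1 y ^ 2 + r ^ 2 * gnorm N 0 y ^ 2
      - gnorm N 1 y ^ 2 := by
    intro r
    have e : Wt N (fun z => (Del N y z + r * y z) ^ 2 - z * deriv y z ^ 2) =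
        Wt N (fun z => ((Del N y z ^ 2 + (2 * r) * (Del N y z * y z)) + r ^ 2 * (y z ^ 2))
          + (-1) * (Ddot y z ^ 2)) := by
      apply wt_congr
      intro z hz
      have := Real.sq_sqrt hz.1
      simp only [Ddot]
      linear_combination (deriv y z) ^ 2 * this
    have := k r
    rw [e, wt_add hN (by fun_prop) (by fun_prop), wt_add hN (by fun_prop) (by fun_prop),
      wt_add hN (by fun_prop) (by fun_prop), wt_smul, wt_smul, wt_smul, p, ← g2, ← g0, ← g1] at this
    have e2 : Wt N (fun z => Ddot y z * Ddot y z) = gnorm N 1 y ^ 2 := by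
      rw [g1]; simp only [sq]
    rw [e2] at this
    linarith
  generalize gnorm N 0 y ^ 2 = A at *
  generalize gnorm N 1 y ^ 2 = B at *
  generalize gnorm N 2 y ^ 2 = C at *
  rcases n0.eq_or_lt with h | h
  · rw [← h] at L ⊢
    linarith
  · have := mul_nonneg h.le (kk (B / A))
    have e : A * (C - 2 * (B / A) * B + (B / A) ^ 2 * A - B) = A * C - B ^ 2 - A * B := by
      field_simp; ring
    rw [e] at this
    linarith

theorem stmt19 (N : ℝ) (hN : 4 ≤ N) (y : ℝ → ℝ) (hy : ContDiff ℝ (⊤ : ℕ∞) y)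
    (hvanish : ∃ δ > (0:ℝ), ∀ z : ℝ, 1 - δ < z → y z = 0) :
    ∀ n : ℕ, 1 ≤ n →
      (gnorm N n y) ^ 2 ≤ gnorm N (n + 1) y * gnorm N (n - 1) y ∧
      (normN N n y) ^ 2 ≤ normN N (n - 1) y * normN N (n + 1) y := by
  obtain ⟨δ, hδ, hv⟩ := hvanish
  have ha : 1 - δ < 1 := by linarith
  have L := logconv hN hy ha hv
  have S := seq_ineq (fun n => gnorm N n y ^ 2) (fun n => sq_nonneg _) L (base_ineq hN hy ha hv)
  intro n hn
  obtain ⟨n, rfl⟩ : ∃ k, n = k + 1 := ⟨n - 1, by omega⟩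
  simp only [Nat.add_sub_cancel, show n + 1 + 1 = n + 2 by ring]
  constructor
  · refine (fun h hb => abs_le_of_sq_le_sq' h hb |>.2 : ∀ {a b : ℝ}, a ^ 2 ≤ b ^ 2 → 0 ≤ b → a ≤ b) ?_ (mul_nonneg (gnorm_nonneg _ _ _) (gnorm_nonneg _ _ _))
    have := L n
    nlinarith
  · have s := S n
    have hT : ∀ k, 0 ≤ ∑ l ∈ Finset.range k, gnorm N l y ^ 2 :=
      fun k => Finset.sum_nonneg fun l _ => sq_nonneg _
    unfold normN
    rw [Real.sq_sqrt (hT _), ← Real.sqrt_mul (hT _)]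
    apply Real.le_sqrt_of_sq_le
    simp only [show n + 1 + 1 = n + 2 by ring, show n + 2 + 1 = n + 3 by ring]
    rw [Finset.sum_range_succ _ (n+2)]
    rw [Finset.sum_range_succ _ (n+1)] at s ⊢
    nlinarith
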